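/- For integers k > ℓ ≥ 1 and n ≥ 2k, one has g(n,k,ℓ) ≥ C(n,k+ℓ)·C(k+ℓ−1,ℓ−1). -/

import Mathlib

/-- `v` is a `{0,1,-1}`-vector of length `n` with exactly `k` coordinates equal to `+1`
and exactly `l` coordinates equal to `-1`, i.e. `v ∈ V(n,k,l)`. -/
def IsPMVec (n k l : ℕ) (v : Fin n → ℤ) : Prop :=
  (∀ i, v i = 0 ∨ v i = 1 ∨ v i = -1) ∧
  (Finset.univ.filter fun i => v i = 1).card = k ∧
  (Finset.univ.filter fun i => v i = -1).card = l

/-- the standard scalar product -/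
def dotZ {n : ℕ} (v w : Fin n → ℤ) : ℤ := ∑ i, v i * w i

/-- `g(n,k,l)`: the maximum size of a family `V ⊆ V(n,k,l)` with
`⟨v,w⟩ > -2l` for all `v, w ∈ V`. -/
noncomputable def gVal (n k l : ℕ) : ℕ :=
  sSup {m | ∃ F : Finset (Fin n → ℤ),
    (∀ v ∈ F, IsPMVec n k l v) ∧
    (∀ v ∈ F, ∀ w ∈ F, -2 * (l : ℤ) < dotZ v w) ∧ F.card = m}

/-- A family of vectors with entries in `{0, 1, -1}` is contained in a finite box, so the
cardinality of any admissible family is a lower bound for `gVal`. -/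
theorem card_le_gVal {n k l : ℕ} (F : Finset (Fin n → ℤ)) (hF : ∀ v ∈ F, IsPMVec n k l v)
    (hdot : ∀ v ∈ F, ∀ w ∈ F, -2 * (l : ℤ) < dotZ v w) : F.card ≤ gVal n k l := by
  refine le_csSup ⟨(Fintype.piFinset fun _ : Fin n => ({0, 1, -1} : Finset ℤ)).card, ?_⟩
    ⟨F, hF, hdot, rfl⟩
  rintro m ⟨G, hG, -, rfl⟩
  refine Finset.card_le_card fun v hv => ?_
  simpa [Fintype.mem_piFinset] using (hG v hv).1

/-- Two vectors whose first nonzero coordinate is `-1` have scalar product greater than `-2l`. -/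
theorem neg_two_mul_lt_dotZ {n k l : ℕ} {v w : Fin n → ℤ} (hv : IsPMVec n k l v)
    (hw : IsPMVec n k l w) {a b : Fin n} (ha : v a = -1) (hav : ∀ i, v i ≠ 0 → a ≤ i)
    (hb : w b = -1) (hbw : ∀ i, w i ≠ 0 → b ≤ i) : -2 * (l : ℤ) < dotZ v w := by
  obtain ⟨hv0, -, hvl⟩ := hv
  obtain ⟨hw0, -, hwl⟩ := hw
  have key : 0 < ∑ i, (v i * w i + (if v i = -1 then 1 else 0) + (if w i = -1 then 1 else 0)) := by
    refine Finset.sum_pos' (fun i _ => ?_) ?_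
    · rcases hv0 i with h | h | h <;> rcases hw0 i with h' | h' | h' <;> simp [h, h']
    · by_cases hwa : w a = 1
      · have hvb : v b ≠ 1 := by
          intro hvb
          have hab : a = b := le_antisymm (hav b (by simp [hvb])) (hbw a (by simp [hwa]))
          subst hab
          omega
        refine ⟨b, Finset.mem_univ b, ?_⟩
        rcases hv0 b with h | h | h <;> simp_all
      · refine ⟨a, Finset.mem_univ a, ?_⟩
        rcases hw0 a with h | h | h <;> simp_all
  rw [Finset.sum_add_distrib, Finset.sum_add_distrib, Finset.sum_boole, Finset.sum_boole,
    hvl, hwl] at key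
  unfold dotZ
  linarith

/-- The vector supported on `S` which is `-1` on `T` and `1` on the rest of `S`. -/
def signVec {n : ℕ} (S T : Finset (Fin n)) (i : Fin n) : ℤ :=
  if i ∈ T then -1 else if i ∈ S then 1 else 0

theorem signVec_eq_neg_one {n : ℕ} {S T : Finset (Fin n)} {i : Fin n} :
    signVec S T i = -1 ↔ i ∈ T := by
  unfold signVec
  split_ifs <;> simp_all

theorem signVec_eq_one {n : ℕ} {S T : Finset (Fin n)} {i : Fin n} :
    signVec S T i = 1 ↔ i ∈ S \ T := by
  unfold signVec
  split_ifs <;> simp_all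

theorem signVec_ne_zero {n : ℕ} {S T : Finset (Fin n)} (h : T ⊆ S) {i : Fin n} :
    signVec S T i ≠ 0 ↔ i ∈ S := by
  unfold signVec
  split_ifs with h₁ h₂
  · simpa using h h₁
  · simpa using h₂
  · simpa using h₂

theorem isPMVec_signVec {n k l : ℕ} {S T : Finset (Fin n)} (h : T ⊆ S) (hS : S.card = k + l)
    (hT : T.card = l) : IsPMVec n k l (signVec S T) := by
  refine ⟨fun i => ?_, ?_, ?_⟩
  · unfold signVec
    split_ifs <;> simp
  · simp only [signVec_eq_one, Finset.filter_univ_mem, Finset.card_sdiff_of_subset h]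
    omega
  · simpa only [signVec_eq_neg_one, Finset.filter_univ_mem] using hT

/-- The `l`-subsets of `S` that contain a least element of `S`. -/
def subsetsWithMin {n : ℕ} (l : ℕ) (S : Finset (Fin n)) : Finset (Finset (Fin n)) :=
  (S.powersetCard l).filter fun T => ∃ a ∈ T, ∀ i ∈ S, a ≤ i

theorem choose_le_card_subsetsWithMin {n l : ℕ} (hl : 1 ≤ l) {S : Finset (Fin n)}
    (hS : S.Nonempty) : (S.card - 1).choose (l - 1) ≤ (subsetsWithMin l S).card := by
  have hm := S.min'_mem hS
  rw [← Finset.card_erase_of_mem hm, ← Finset.card_powersetCard]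
  have hnot : ∀ T ∈ (S.erase (S.min' hS)).powersetCard (l - 1), S.min' hS ∉ T :=
    fun T hT h => by simpa using (Finset.mem_powersetCard.1 hT).1 h
  refine Finset.card_le_card_of_injOn (insert (S.min' hS)) (fun T hT => ?_) fun T hT U hU h => ?_
  · have hT' := Finset.mem_powersetCard.1 hT
    refine Finset.mem_filter.2 ⟨Finset.mem_powersetCard.2 ⟨?_, ?_⟩, S.min' hS, by simp,
      fun i hi => S.min'_le i hi⟩
    · exact Finset.insert_subset hm (hT'.1.trans (Finset.erase_subset _ _))
    · rw [Finset.card_insert_of_notMem (hnot T hT), hT'.2]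
      omega
  · rw [← Finset.erase_insert (hnot T hT), ← Finset.erase_insert (hnot U hU)]
    exact congrArg (fun X => X.erase (S.min' hS)) h

/-- For integers `k > l ≥ 1` and `n ≥ 2k`,
one has `g(n,k,l) ≥ C(n,k+l)·C(k+l-1,l-1)`. -/
theorem stmt_2 (k l n : ℕ) (hl : 1 ≤ l) (hlk : l < k) (hn : 2 * k ≤ n) :
    Nat.choose n (k + l) * Nat.choose (k + l - 1) (l - 1) ≤ gVal n k l := by
  set P := ((Finset.univ : Finset (Fin n)).powersetCard (k + l)).sigma (subsetsWithMin l) with hP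
  have hmem : ∀ p ∈ P, p.1.card = k + l ∧ p.2 ⊆ p.1 ∧ p.2.card = l ∧
      ∃ a ∈ p.2, ∀ i ∈ p.1, a ≤ i := by
    intro p hp
    simpa [hP, subsetsWithMin, and_assoc] using hp
  have hcard : n.choose (k + l) * (k + l - 1).choose (l - 1) ≤ P.card := by
    rw [hP, Finset.card_sigma]
    calc _ = ((Finset.univ : Finset (Fin n)).powersetCard (k + l)).card •
          (k + l - 1).choose (l - 1) := by simp
      _ ≤ _ := Finset.card_nsmul_le_sum _ _ _ fun S hS => by
        have hS' := (Finset.mem_powersetCard.1 hS).2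
        rw [← hS']
        exact choose_le_card_subsetsWithMin hl (Finset.card_pos.1 (by omega))
  have hinj : Set.InjOn (fun p : (_ : Finset (Fin n)) × Finset (Fin n) => signVec p.1 p.2) P := by
    rintro ⟨S, T⟩ hp ⟨S', T'⟩ hq h
    have hTS := (hmem _ hp).2.1
    have hTS' := (hmem _ hq).2.1
    dsimp only at h hTS hTS'
    have hS : S = S' := by
      ext i
      rw [← signVec_ne_zero hTS, h, signVec_ne_zero hTS']
    have hT : T = T' := by
      ext i
      rw [← signVec_eq_neg_one (S := S), h, signVec_eq_neg_one]
    rw [hS, hT]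
  rw [← Finset.card_image_of_injOn hinj] at hcard
  refine hcard.trans (card_le_gVal _ ?_ ?_)
  · simp only [Finset.forall_mem_image]
    intro p hp
    obtain ⟨hS, hTS, hT, -⟩ := hmem p hp
    exact isPMVec_signVec hTS hS hT
  · simp only [Finset.forall_mem_image]
    intro p hp q hq
    obtain ⟨hS, hTS, hT, a, haT, ha⟩ := hmem p hp
    obtain ⟨hS', hTS', hT', b, hbT, hb⟩ := hmem q hq
    exact neg_two_mul_lt_dotZ (isPMVec_signVec hTS hS hT) (isPMVec_signVec hTS' hS' hT')
      (signVec_eq_neg_one.2 haT) (fun i hi => ha i ((signVec_ne_zero hTS).1 hi))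
      (signVec_eq_neg_one.2 hbT) (fun i hi => hb i ((signVec_ne_zero hTS').1 hi))
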